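/- A Banach space with an unconditional Schauder basis is reflexive if and only if it contains no closed subspace linearly isomorphic to c₀ and no closed subspace linearly isomorphic to ℓ¹. -/

import Mathlib

open Filter

/-- `x` is a Schauder basis of `B`. -/
def IsSchauderBasis {B : Type*} [NormedAddCommGroup B] [NormedSpace ℝ B] (x : ℕ → B) : Prop :=
  ∀ y : B, ∃! a : ℕ → ℝ,
    Tendsto (fun N => ∑ i ∈ Finset.range N, a i • x i) atTop (nhds y)

/-- The basis `x` is unconditional: every basis expansion converges unconditionally. -/
def IsUnconditional {B : Type*} [NormedAddCommGroup B] [NormedSpace ℝ B] (x : ℕ → B) : Prop :=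
  ∀ (y : B) (a : ℕ → ℝ),
    Tendsto (fun N => ∑ i ∈ Finset.range N, a i • x i) atTop (nhds y) →
    HasSum (fun i => a i • x i) y

/-- A functional on a space embedded in `B` by a map bounded below extends to `B`. -/
theorem exists_comp_eq_of_bounded_below {X B : Type*} [NormedAddCommGroup X] [NormedSpace ℝ X]
    [CompleteSpace X] [NormedAddCommGroup B] [NormedSpace ℝ B] (T : X →L[ℝ] B) {c : ℝ}
    (hc : 0 < c) (hT : ∀ v, c * ‖v‖ ≤ ‖T v‖) (ψ : StrongDual ℝ X) :
    ∃ φ : StrongDual ℝ B, φ.comp T = ψ := by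
  have hinj : Function.Injective T := by
    refine (injective_iff_map_eq_zero T).2 fun v hv => norm_le_zero_iff.1 ?_
    have := hT v
    rw [hv, norm_zero] at this
    exact nonpos_of_mul_nonpos_right this hc
  let e : X ≃ₗ[ℝ] T.toLinearMap.range := LinearEquiv.ofInjective T.toLinearMap hinj
  have he : ∀ v, (e v : B) = T v := fun v => rfl
  let S : T.toLinearMap.range →L[ℝ] X := e.symm.toLinearMap.mkContinuous c⁻¹ fun w => by
    obtain ⟨v, rfl⟩ := e.surjective w
    simp only [LinearEquiv.coe_coe, LinearEquiv.symm_apply_apply]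
    rw [le_inv_mul_iff₀ hc]
    exact hT v
  obtain ⟨φ, hφ, -⟩ := exists_extension_norm_eq T.toLinearMap.range (ψ.comp S)
  refine ⟨φ, ContinuousLinearMap.ext fun v => ?_⟩
  have := hφ (e v)
  rw [he] at this
  simpa [S] using this

/-- A bounded sequence of functionals converges pointwise along `hyperfilter ℕ`. -/
theorem exists_tendsto_hyperfilter_of_norm_le {E : Type*} [NormedAddCommGroup E] [NormedSpace ℝ E]
    (g : ℕ → StrongDual ℝ E) {M : ℝ} (hg : ∀ n, ‖g n‖ ≤ M) :
    ∃ G : StrongDual ℝ E, ∀ e : E,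
      Tendsto (fun n => g n e) (hyperfilter ℕ : Filter ℕ) (nhds (G e)) := by
  obtain ⟨G, -, hG⟩ := isCompact_iff_ultrafilter_le_nhds.1
    (WeakDual.isCompact_closedBall (𝕜 := ℝ) (E := E) 0 M)
    ((hyperfilter ℕ).map fun n => StrongDual.toWeakDual (g n)) (by
    rw [le_principal_iff]
    refine Ultrafilter.mem_map.2 (Filter.univ_mem' fun n => ?_)
    exact mem_closedBall_zero_iff.2 (hg n))
  exact ⟨WeakDual.toStrongDual G, fun e => ((WeakDual.eval_continuous e).tendsto G).comp hG⟩

/-- In a space which embeds in a reflexive space, bounded sequences converge weakly along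
`hyperfilter ℕ`. -/
theorem exists_tendsto_hyperfilter_of_reflexive {X B : Type*} [NormedAddCommGroup X]
    [NormedSpace ℝ X] [CompleteSpace X] [NormedAddCommGroup B] [NormedSpace ℝ B]
    (hB : Function.Surjective (NormedSpace.inclusionInDoubleDual ℝ B)) (T : X →L[ℝ] B) {c : ℝ}
    (hc : 0 < c) (hT : ∀ v, c * ‖v‖ ≤ ‖T v‖) (x : ℕ → X) {M : ℝ} (hx : ∀ n, ‖x n‖ ≤ M) :
    ∃ v : X, ∀ ψ : StrongDual ℝ X,
      Tendsto (fun n => ψ (x n)) (hyperfilter ℕ : Filter ℕ) (nhds (ψ v)) := by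
  obtain ⟨G, hG⟩ := exists_tendsto_hyperfilter_of_norm_le
    (fun n => NormedSpace.inclusionInDoubleDual ℝ B (T (x n))) (M := ‖T‖ * M) fun n =>
      (NormedSpace.double_dual_bound ℝ B _).trans ((T.le_opNorm _).trans
        (mul_le_mul_of_nonneg_left (hx n) (norm_nonneg T)))
  obtain ⟨y, rfl⟩ := hB G
  have key : ∀ φ : StrongDual ℝ B,
      Tendsto (fun n => φ (T (x n))) (hyperfilter ℕ : Filter ℕ) (nhds (φ y)) := hG
  have hclosed : IsClosed (Set.range T) := by
    have hanti : AntilipschitzWith (Real.toNNReal c⁻¹) T :=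
      AddMonoidHomClass.antilipschitz_of_bound T fun v => by
        rw [Real.coe_toNNReal _ (inv_nonneg.2 hc.le), le_inv_mul_iff₀ hc]
        exact hT v
    exact hanti.isClosed_range T.uniformContinuous
  have hconv : Convex ℝ (Set.range T) := by
    rw [← Set.image_univ]
    exact convex_univ.is_linear_image T.toLinearMap.isLinear
  have hmem : y ∈ Set.range T := by
    by_contra hn
    obtain ⟨f, u, hfy, hfu⟩ := geometric_hahn_banach_point_closed hconv hclosed hn
    exact hfy.not_ge (ge_of_tendsto' (key f) fun n => (hfu _ ⟨x n, rfl⟩).le)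
  obtain ⟨v, rfl⟩ := hmem
  refine ⟨v, fun ψ => ?_⟩
  obtain ⟨φ, rfl⟩ := exists_comp_eq_of_bounded_below T hc hT ψ
  exact key φ

/-- A reflexive space does not contain `c₀`. -/
theorem not_bounded_below_c0_of_reflexive {B : Type*} [NormedAddCommGroup B] [NormedSpace ℝ B]
    (hB : Function.Surjective (NormedSpace.inclusionInDoubleDual ℝ B)) :
    ¬ ∃ (T : ZeroAtInftyContinuousMap ℕ ℝ →L[ℝ] B) (c : ℝ), 0 < c ∧
      ∀ v, c * ‖v‖ ≤ ‖T v‖ := by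
  rintro ⟨T, c, hc, hT⟩
  let x : ℕ → ZeroAtInftyContinuousMap ℕ ℝ := fun n =>
    { toFun := fun j => if j < n then 1 else 0
      continuous_toFun := continuous_of_discreteTopology
      zero_at_infty' := by
        rw [cocompact_eq_cofinite, Nat.cofinite_eq_atTop]
        refine tendsto_const_nhds.congr' ?_
        filter_upwards [eventually_ge_atTop n] with j hj
        simp [hj.not_gt] }
  have hxa : ∀ n j, x n j = if j < n then 1 else 0 := fun _ _ => rfl
  have hx : ∀ n, ‖x n‖ ≤ 1 := fun n => by
    rw [← ZeroAtInftyContinuousMap.norm_toBCF_eq_norm]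
    refine (BoundedContinuousFunction.norm_le zero_le_one).2 fun j => ?_
    change ‖x n j‖ ≤ 1
    rw [hxa]
    split_ifs <;> simp
  obtain ⟨v, hv⟩ := exists_tendsto_hyperfilter_of_reflexive hB T hc hT x hx
  have hone : ∀ j, v j = 1 := fun j => by
    let ψ : StrongDual ℝ (ZeroAtInftyContinuousMap ℕ ℝ) := LinearMap.mkContinuous
      { toFun := fun f => f j
        map_add' := fun _ _ => rfl
        map_smul' := fun _ _ => rfl } 1 fun f => by
          rw [one_mul, ← ZeroAtInftyContinuousMap.norm_toBCF_eq_norm]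
          exact f.toBCF.norm_coe_le_norm j
    refine tendsto_nhds_unique (hv ψ) (tendsto_const_nhds.congr' ?_)
    refine Filter.Eventually.filter_mono Nat.hyperfilter_le_atTop ?_
    filter_upwards [eventually_gt_atTop j] with n hn
    change 1 = x n j
    rw [hxa, if_pos hn]
  have hz := v.zero_at_infty'
  rw [cocompact_eq_cofinite, Nat.cofinite_eq_atTop] at hz
  exact zero_ne_one (tendsto_nhds_unique hz (tendsto_const_nhds.congr fun j => (hone j).symm))

/-- A reflexive space does not contain `ℓ¹`. -/
theorem not_bounded_below_l1_of_reflexive {B : Type*} [NormedAddCommGroup B] [NormedSpace ℝ B]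
    (hB : Function.Surjective (NormedSpace.inclusionInDoubleDual ℝ B)) :
    ¬ ∃ (T : lp (fun _ : ℕ => ℝ) 1 →L[ℝ] B) (c : ℝ), 0 < c ∧
      ∀ v, c * ‖v‖ ≤ ‖T v‖ := by
  rintro ⟨T, c, hc, hT⟩
  let x : ℕ → lp (fun _ : ℕ => ℝ) 1 := fun n => lp.single 1 n 1
  have hx : ∀ n, ‖x n‖ ≤ 1 := fun n => by
    simp [x, lp.norm_single]
  obtain ⟨v, hv⟩ := exists_tendsto_hyperfilter_of_reflexive hB T hc hT x hx
  have hzero : v = 0 := by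
    ext j
    let ψ : StrongDual ℝ (lp (fun _ : ℕ => ℝ) 1) := lp.evalCLM ℝ (fun _ : ℕ => ℝ) 1 j
    refine tendsto_nhds_unique (hv ψ) (tendsto_const_nhds.congr' ?_)
    refine Filter.Eventually.filter_mono Nat.hyperfilter_le_atTop ?_
    filter_upwards [eventually_gt_atTop j] with n hn
    change 0 = x n j
    simp [x, hn.ne]
  have h1 := hv (lp.tsumCLM ℝ ℕ ℝ)
  rw [hzero, map_zero] at h1
  refine zero_ne_one (tendsto_nhds_unique h1 (tendsto_const_nhds.congr fun n => ?_))
  change 1 = ∑' j, x n j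
  rw [tsum_eq_single n fun j hj => by simp [x, hj]]
  simp [x]

/-- A basis vector is nonzero. -/
theorem IsSchauderBasis.ne_zero {B : Type*} [NormedAddCommGroup B] [NormedSpace ℝ B] {z : ℕ → B}
    (hb : IsSchauderBasis z) (n : ℕ) : z n ≠ 0 := fun h => by
  have h0 : Tendsto (fun N => ∑ i ∈ Finset.range N, (0 : ℕ → ℝ) i • z i) atTop (nhds 0) := by
    simp
  have h1 : Tendsto (fun N => ∑ i ∈ Finset.range N, (Pi.single n 1 : ℕ → ℝ) i • z i)
      atTop (nhds 0) := by
    refine tendsto_const_nhds.congr fun N => (Finset.sum_eq_zero fun i _ => ?_).symm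
    by_cases hi : i = n
    · rw [hi, h, smul_zero]
    · rw [Pi.single_eq_of_ne hi, zero_smul]
  have := congrFun ((hb 0).unique h0 h1) n
  simp at this

/-- The coordinate functionals of a Schauder basis of a Banach space are continuous. -/
theorem IsSchauderBasis.exists_coord {B : Type*} [NormedAddCommGroup B] [NormedSpace ℝ B]
    [CompleteSpace B] {z : ℕ → B} (hb : IsSchauderBasis z) :
    ∃ f : ℕ → StrongDual ℝ B, ∀ y : B,
      Tendsto (fun N => ∑ i ∈ Finset.range N, f i y • z i) atTop (nhds y) := by
  choose g hg using fun n => SeparatingDual.exists_eq_one (R := ℝ) (hb.ne_zero n)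
  let ev : ∀ t : OnePoint ℕ, C(OnePoint ℕ, B) →L[ℝ] B := fun t => ContinuousMap.evalCLM ℝ t
  let d : ℕ → C(OnePoint ℕ, B) →L[ℝ] B := fun n =>
    ev ((n + 1 : ℕ) : OnePoint ℕ) - ev (n : OnePoint ℕ)
  let W : Submodule ℝ C(OnePoint ℕ, B) :=
    (ev ((0 : ℕ) : OnePoint ℕ)).toLinearMap.ker ⊓
      ⨅ n, (d n - ((g n).comp (d n)).smulRight (z n)).toLinearMap.ker
  have hW : ∀ s : C(OnePoint ℕ, B), s ∈ W ↔ s ((0 : ℕ) : OnePoint ℕ) = 0 ∧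
      ∀ n, d n s = g n (d n s) • z n := fun s => by
    simp [W, ev, sub_eq_zero]
  have hWc : IsClosed (W : Set C(OnePoint ℕ, B)) := by
    simp only [W, Submodule.coe_inf, Submodule.coe_iInf]
    exact (ContinuousLinearMap.isClosed_ker _).inter
      (isClosed_iInter fun n => ContinuousLinearMap.isClosed_ker _)
  have : CompleteSpace W := hWc.completeSpace_coe
  have hsum : ∀ s ∈ W, ∀ N : ℕ,
      ∑ i ∈ Finset.range N, g i (d i s) • z i = s (N : OnePoint ℕ) := fun s hs N => by
    obtain ⟨h0, h1⟩ := (hW s).1 hs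
    rw [Finset.sum_congr rfl fun i _ => (h1 i).symm]
    exact (Finset.sum_range_sub (fun i : ℕ => s (i : OnePoint ℕ)) N).trans (by rw [h0, sub_zero])
  have htend : ∀ s ∈ W, Tendsto (fun N => ∑ i ∈ Finset.range N, g i (d i s) • z i) atTop
      (nhds (s OnePoint.infty)) := fun s hs => by
    simp only [hsum s hs]
    exact (OnePoint.continuous_iff_from_nat s).1 (map_continuous s)
  let L : W →L[ℝ] B := (ev OnePoint.infty).comp W.subtypeL
  have hker : L.ker = ⊥ := by
    refine LinearMap.ker_eq_bot'.2 fun s hs => ?_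
    have hs' : (s : C(OnePoint ℕ, B)) OnePoint.infty = 0 := hs
    have h1 := htend s s.2
    rw [hs'] at h1
    have h0 : Tendsto (fun N => ∑ i ∈ Finset.range N, (0 : ℕ → ℝ) i • z i) atTop (nhds 0) := by
      simp
    have h2 := (hb 0).unique h1 h0
    refine Subtype.ext (ContinuousMap.ext fun t => ?_)
    induction t using OnePoint.rec with
    | infty => exact hs'
    | coe N =>
      rw [← hsum s s.2 N]
      exact Finset.sum_eq_zero fun i _ => by
        rw [show g i (d i s) = 0 from congrFun h2 i, zero_smul]
  have hrange : L.range = ⊤ := by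
    refine LinearMap.range_eq_top.2 fun y => ?_
    obtain ⟨a, ha, -⟩ := hb y
    let s := OnePoint.continuousMapMkNat _ _ ha
    have hd : ∀ n, d n s = a n • z n := fun n =>
      sub_eq_of_eq_add' (Finset.sum_range_succ (fun i => a i • z i) n)
    refine ⟨⟨s, (hW s).2 ⟨Finset.sum_range_zero fun i => a i • z i, fun n => ?_⟩⟩, rfl⟩
    rw [hd, map_smul, hg, smul_eq_mul, mul_one]
  let e := ContinuousLinearEquiv.ofBijective L hker hrange
  refine ⟨fun n => (g n).comp ((d n).comp (W.subtypeL.comp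
    (e.symm : B →L[ℝ] W))), fun y => ?_⟩
  have := htend (e.symm y) (e.symm y).2
  rwa [show (e.symm y : C(OnePoint ℕ, B)) OnePoint.infty = y from
    ContinuousLinearEquiv.ofBijective_apply_symm_apply L hker hrange y] at this

/-- An unconditional Schauder basis of a Banach space, with its coordinate functionals. -/
theorem IsSchauderBasis.exists_unconditionalSchauderBasis {B : Type*} [NormedAddCommGroup B]
    [NormedSpace ℝ B] [CompleteSpace B] {z : ℕ → B} (hb : IsSchauderBasis z)
    (hu : IsUnconditional z) : Nonempty (UnconditionalSchauderBasis ℕ ℝ B) := by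
  obtain ⟨f, hf⟩ := hb.exists_coord
  refine ⟨⟨z, f, fun i j => ?_, fun x => hu x _ (hf x)⟩⟩
  classical
  have h : Tendsto (fun N => ∑ k ∈ Finset.range N, (Pi.single j 1 : ℕ → ℝ) k • z k) atTop
      (nhds (z j)) := by
    refine tendsto_const_nhds.congr' ?_
    filter_upwards [eventually_gt_atTop j] with N hN
    rw [Finset.sum_eq_single_of_mem j (Finset.mem_range.2 hN) fun i _ hi => by
      rw [Pi.single_eq_of_ne hi, zero_smul], Pi.single_eq_same, one_smul]
  convert! congrFun ((hb (z j)).unique (hf (z j)) h) i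

namespace UnconditionalSchauderBasis

variable {B : Type*} [NormedAddCommGroup B] [NormedSpace ℝ B] [CompleteSpace B]
  (b : UnconditionalSchauderBasis ℕ ℝ B)

/-- The series `∑ φ (bᵢ* x • bᵢ)` converge absolutely, uniformly on bounded sets. -/
theorem exists_sum_abs_le : ∃ K : ℝ, 0 < K ∧ ∀ (φ : StrongDual ℝ B) (x : B) (A : Finset ℕ),
    ∑ i ∈ A, |φ (b.coord i x • b i)| ≤ K * ‖φ‖ * ‖x‖ := by
  obtain ⟨C, hC⟩ := b.exists_norm_proj_le
  have hC0 : 0 ≤ C := (norm_nonneg _).trans (hC ∅)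
  refine ⟨2 * C + 1, by positivity, fun φ x A => ?_⟩
  have hP : ∀ A : Finset ℕ, |∑ i ∈ A, φ (b.coord i x • b i)| ≤ C * ‖φ‖ * ‖x‖ := fun A => by
    rw [← map_sum, ← b.proj_apply, ← Real.norm_eq_abs]
    calc ‖φ (b.proj A x)‖ ≤ ‖φ‖ * (‖b.proj A‖ * ‖x‖) :=
          φ.le_opNorm_of_le ((b.proj A).le_opNorm x)
      _ ≤ ‖φ‖ * (C * ‖x‖) := by gcongr; exact hC A
      _ = C * ‖φ‖ * ‖x‖ := by ring
  rw [← Finset.sum_filter_add_sum_filter_not A fun i => 0 ≤ φ (b.coord i x • b i)]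
  rw [Finset.sum_congr rfl fun i hi => abs_of_nonneg (Finset.mem_filter.1 hi).2,
    Finset.sum_congr rfl fun i hi => abs_of_neg (not_le.1 (Finset.mem_filter.1 hi).2),
    Finset.sum_neg_distrib]
  have h1 := (le_abs_self _).trans (hP (A.filter fun i => 0 ≤ φ (b.coord i x • b i)))
  have h2 := (neg_le_abs _).trans (hP (A.filter fun i => ¬ 0 ≤ φ (b.coord i x • b i)))
  have h3 : 0 ≤ ‖φ‖ * ‖x‖ := by positivity
  linarith

/-- Projections onto disjoint blocks satisfy an absolute summability estimate. -/
theorem exists_sum_abs_proj_le : ∃ K : ℝ, 0 < K ∧ ∀ (φ : StrongDual ℝ B) (x : B)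
    (t : ℕ → Finset ℕ), Pairwise (Function.onFun Disjoint t) → ∀ A : Finset ℕ,
    ∑ k ∈ A, |φ (b.proj (t k) x)| ≤ K * ‖φ‖ * ‖x‖ := by
  obtain ⟨K, hK0, hK⟩ := b.exists_sum_abs_le
  refine ⟨K, hK0, fun φ x t ht A => ?_⟩
  refine le_trans ?_ (hK φ x (A.biUnion t))
  rw [Finset.sum_biUnion fun i _ j _ hij => ht hij]
  refine Finset.sum_le_sum fun k _ => ?_
  rw [b.proj_apply, map_sum]
  exact Finset.abs_sum_le_sum_abs _ _

omit [CompleteSpace B] in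
/-- Composition of projections, with the standard decidable equality on `ℕ`. -/
theorem proj_proj (s t : Finset ℕ) (x : B) : b.proj s (b.proj t x) = b.proj (s ∩ t) x := by
  rw [b.proj_comp]
  congr!

omit [CompleteSpace B] in
/-- Projecting a series of disjointly supported blocks onto one of the blocks. -/
theorem proj_hasSum_blocks {t : ℕ → Finset ℕ} (ht : Pairwise (Function.onFun Disjoint t))
    {u : ℕ → B} (hu : ∀ k, b.proj (t k) (u k) = u k) {c : ℕ → ℝ} {y : B}
    (hy : HasSum (fun k => c k • u k) y) (j : ℕ) : b.proj (t j) y = c j • u j := by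
  have h := (b.proj (t j)).hasSum hy
  refine h.unique ?_
  have hj : c j • u j = b.proj (t j) (c j • u j) := by rw [map_smul, hu]
  rw [hj]
  refine hasSum_single j fun k hk => ?_
  rw [map_smul, ← hu k, b.proj_proj,
    Finset.disjoint_iff_inter_eq_empty.1 (ht hk.symm), b.proj_empty]
  simp

end UnconditionalSchauderBasis

/-- If a series in a Banach space is not summable, there are disjoint blocks with norms bounded
below. -/
theorem exists_disjoint_blocks_of_not_summable {E : Type*} [NormedAddCommGroup E]
    [CompleteSpace E] {f : ℕ → E} (hf : ¬ Summable f) :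
    ∃ ε : ℝ, 0 < ε ∧ ∃ t : ℕ → Finset ℕ, Pairwise (Function.onFun Disjoint t) ∧
      ∀ k, ε ≤ ‖∑ i ∈ t k, f i‖ := by
  rw [summable_iff_vanishing_norm] at hf
  push Not at hf
  obtain ⟨ε, hε, h⟩ := hf
  obtain ⟨t, h1, h2⟩ := exists_seq_of_forall_finset_exists'
    (fun s : Finset ℕ => ε ≤ ‖∑ i ∈ s, f i‖) Disjoint fun S _ => by
      obtain ⟨t, ht, hεt⟩ := h (S.biUnion id)
      exact ⟨t, hεt, fun x hx =>
        ((Finset.disjoint_biUnion_right _ _ _).1 ht x hx).symm⟩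
  exact ⟨ε, hε, t, h2, h1⟩

/-- A pointwise summable family of rank one operators with bounded partial sums defines a
continuous linear map. -/
theorem exists_clm_hasSum_smul {X B : Type*} [NormedAddCommGroup X] [NormedSpace ℝ X]
    [NormedAddCommGroup B] [NormedSpace ℝ B] (e : ℕ → X →ₗ[ℝ] ℝ) (u : ℕ → B) (K : ℝ)
    (hs : ∀ x, Summable fun k => e k x • u k)
    (hK : ∀ x (A : Finset ℕ), ‖∑ k ∈ A, e k x • u k‖ ≤ K * ‖x‖) :
    ∃ T : X →L[ℝ] B, ∀ x, HasSum (fun k => e k x • u k) (T x) := by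
  let T : X →ₗ[ℝ] B :=
    { toFun := fun x => ∑' k, e k x • u k
      map_add' := fun x y => by
        simp only [map_add, add_smul]
        exact (hs x).tsum_add (hs y)
      map_smul' := fun r x => by
        simp only [map_smul, smul_assoc, RingHom.id_apply]
        exact (hs x).tsum_const_smul r }
  exact ⟨T.mkContinuous K fun x => le_of_tendsto' (hs x).hasSum.norm (hK x), fun x => (hs x).hasSum⟩

namespace UnconditionalSchauderBasis

variable {B : Type*} [NormedAddCommGroup B] [NormedSpace ℝ B] [CompleteSpace B]
  (b : UnconditionalSchauderBasis ℕ ℝ B)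

/-- An unconditional basis of a space without `ℓ¹` is shrinking. -/
theorem summable_dual_of_no_l1
    (h : ¬ ∃ (T : lp (fun _ : ℕ => ℝ) 1 →L[ℝ] B) (c : ℝ), 0 < c ∧ ∀ v, c * ‖v‖ ≤ ‖T v‖)
    (φ : StrongDual ℝ B) : Summable fun i => φ (b i) • b.coord i := by
  by_contra hn
  obtain ⟨ε, hε, t, ht, hεt⟩ := exists_disjoint_blocks_of_not_summable hn
  obtain ⟨C, hC⟩ := b.exists_norm_proj_le
  have hC0 : 0 ≤ C := (norm_nonneg _).trans (hC ∅)
  obtain ⟨K, hK0, hK⟩ := b.exists_sum_abs_proj_le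
  have hφt : ∀ k, ∑ i ∈ t k, φ (b i) • b.coord i = φ.comp (b.proj (t k)) := fun k => by
    ext x
    simp [mul_comm]
  have hx : ∀ k, ∃ x : B, ‖x‖ < 1 ∧ ε / 2 < ‖φ.comp (b.proj (t k)) x‖ := fun k =>
    ContinuousLinearMap.exists_lt_apply_of_lt_opNorm _
      ((half_lt_self hε).trans_le (hφt k ▸ hεt k))
  choose x hx1 hx2 using hx
  let u : ℕ → B := fun k => b.proj (t k) (x k)
  have hu : ∀ k, b.proj (t k) (u k) = u k := fun k => by
    simp only [u]
    rw [b.proj_proj, Finset.inter_self]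
  have huC : ∀ k, ‖u k‖ ≤ C := fun k =>
    (b.proj (t k)).le_of_opNorm_le_of_le (hC _) (hx1 k).le |>.trans_eq (mul_one C)
  have hnorm : ∀ v : lp (fun _ : ℕ => ℝ) 1, HasSum (fun k => ‖v k‖) ‖v‖ := fun v => by
    simpa using lp.hasSum_norm (p := 1) (by simp) v
  have hle : ∀ (v : lp (fun _ : ℕ => ℝ) 1) k, ‖v k • u k‖ ≤ ‖v k‖ * C := fun v k => by
    rw [norm_smul]
    exact mul_le_mul_of_nonneg_left (huC k) (norm_nonneg _)
  obtain ⟨T, hT⟩ := exists_clm_hasSum_smul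
    (fun k => (lp.evalCLM ℝ (fun _ : ℕ => ℝ) 1 k).toLinearMap) u C
    (fun v => ((hnorm v).summable.mul_right C).of_norm_bounded (hle v)) fun v A => by
      refine (norm_sum_le_of_le A fun k _ => hle v k).trans ?_
      rw [← Finset.sum_mul, mul_comm]
      exact mul_le_mul_of_nonneg_left
        (sum_le_hasSum A (fun _ _ => norm_nonneg _) (hnorm v)) hC0
  refine h ⟨T, ε / 2 / (K * (‖φ‖ + 1)), by positivity, fun v => ?_⟩
  rw [div_mul_eq_mul_div, div_le_iff₀ (by positivity)]
  refine hasSum_le_of_sum_le ((hnorm v).mul_left (ε / 2)) fun A => ?_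
  calc ∑ k ∈ A, ε / 2 * ‖v k‖ ≤ ∑ k ∈ A, |φ (b.proj (t k) (T v))| :=
        Finset.sum_le_sum fun k _ => by
          rw [b.proj_hasSum_blocks ht hu (hT v) k, map_smul, smul_eq_mul, abs_mul, mul_comm]
          exact mul_le_mul_of_nonneg_left (hx2 k).le (norm_nonneg (v k))
    _ ≤ K * ‖φ‖ * ‖T v‖ := hK φ _ t ht A
    _ ≤ ‖T v‖ * (K * (‖φ‖ + 1)) := by
        have : 0 ≤ K * ‖T v‖ := by positivity
        linarith

/-- An unconditional basis of a space without `c₀` is boundedly complete. -/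
theorem summable_of_no_c0
    (h : ¬ ∃ (T : ZeroAtInftyContinuousMap ℕ ℝ →L[ℝ] B) (c : ℝ), 0 < c ∧
      ∀ v, c * ‖v‖ ≤ ‖T v‖)
    {a : ℕ → ℝ} {M : ℝ} (hM : ∀ s : Finset ℕ, ‖∑ i ∈ s, a i • b i‖ ≤ M) :
    Summable fun i => a i • b i := by
  by_contra hn
  obtain ⟨ε, hε, t, ht, hεt⟩ := exists_disjoint_blocks_of_not_summable hn
  obtain ⟨C, hC⟩ := b.exists_norm_proj_le
  have hC0 : 0 ≤ C := (norm_nonneg _).trans (hC ∅)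
  obtain ⟨K, hK0, hK⟩ := b.exists_sum_abs_proj_le
  have hM0 : 0 ≤ M := (norm_nonneg _).trans (hM ∅)
  let u : ℕ → B := fun k => ∑ i ∈ t k, a i • b i
  have hsub : ∀ s r : Finset ℕ, s ⊆ r → b.proj s (∑ i ∈ r, a i • b i) = ∑ i ∈ s, a i • b i :=
    fun s r hsr => by
      simp only [map_sum, map_smul, b.proj_apply_basis_mem]
      simp [Finset.inter_eq_right.2 hsr]
  have hu : ∀ k, b.proj (t k) (u k) = u k := fun k => hsub _ _ subset_rfl
  have hbound : ∀ (c : ℕ → ℝ) (δ : ℝ) (A : Finset ℕ), 0 ≤ δ → (∀ k ∈ A, |c k| ≤ δ) →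
      ‖∑ k ∈ A, c k • u k‖ ≤ δ * (K * M) := fun c δ A hδ hc => by
    refine NormedSpace.norm_le_dual_bound ℝ _ (by positivity) fun φ => ?_
    have hA : ∀ k ∈ A, b.proj (t k) (∑ i ∈ A.biUnion t, a i • b i) = u k := fun k hk =>
      hsub _ _ (Finset.subset_biUnion_of_mem t hk)
    calc ‖φ (∑ k ∈ A, c k • u k)‖ ≤ ∑ k ∈ A, ‖φ (c k • u k)‖ := by
          rw [map_sum]; exact norm_sum_le _ _
      _ ≤ ∑ k ∈ A, δ * |φ (b.proj (t k) (∑ i ∈ A.biUnion t, a i • b i))| :=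
          Finset.sum_le_sum fun k hk => by
            rw [hA k hk, map_smul, norm_smul]
            exact mul_le_mul_of_nonneg_right (hc k hk) (abs_nonneg _)
      _ ≤ δ * (K * ‖φ‖ * M) := by
          rw [← Finset.mul_sum]
          refine mul_le_mul_of_nonneg_left ((hK φ _ t ht A).trans ?_) hδ
          exact mul_le_mul_of_nonneg_left (hM _) (by positivity)
      _ = δ * (K * M) * ‖φ‖ := by ring
  have hcoord : ∀ (v : ZeroAtInftyContinuousMap ℕ ℝ) k, |v k| ≤ ‖v‖ := fun v k => by
    rw [← ZeroAtInftyContinuousMap.norm_toBCF_eq_norm]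
    exact v.toBCF.norm_coe_le_norm k
  obtain ⟨T, hT⟩ := exists_clm_hasSum_smul
    (fun k => { toFun := fun v : ZeroAtInftyContinuousMap ℕ ℝ => v k
                map_add' := fun _ _ => rfl
                map_smul' := fun _ _ => rfl }) u (K * M) (fun v => by
      refine summable_iff_vanishing_norm.2 fun δ hδ => ?_
      have hv := v.zero_at_infty'
      rw [cocompact_eq_cofinite] at hv
      have hη : 0 < δ / 2 / (K * M + 1) := by positivity
      have hfin : {k | ¬ |v k| < δ / 2 / (K * M + 1)}.Finite := by
        have := Metric.tendsto_nhds.1 hv _ hη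
        simpa [Real.dist_eq] using this
      refine ⟨hfin.toFinset, fun A hA => ?_⟩
      refine (hbound v _ A hη.le fun k hk => ?_).trans_lt ?_
      · by_contra hlt
        exact Finset.disjoint_left.1 hA hk (hfin.mem_toFinset.2 fun h' => hlt h'.le)
      · rw [div_mul_eq_mul_div, div_lt_iff₀ (by positivity)]
        nlinarith [mul_nonneg hK0.le hM0]) fun v A => by
      rw [mul_comm]
      exact hbound v _ A (norm_nonneg v) fun k _ => hcoord v k
  refine h ⟨T, ε / (C + 1), by positivity, fun v => ?_⟩
  rw [div_mul_eq_mul_div, div_le_iff₀ (by positivity), mul_comm, ← le_div_iff₀ hε,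
    ← ZeroAtInftyContinuousMap.norm_toBCF_eq_norm]
  refine (BoundedContinuousFunction.norm_le (by positivity)).2 fun k => ?_
  change |v k| ≤ _
  rw [le_div_iff₀ hε]
  calc |v k| * ε ≤ |v k| * ‖u k‖ := mul_le_mul_of_nonneg_left (hεt k) (abs_nonneg _)
    _ = ‖b.proj (t k) (T v)‖ := by
        rw [b.proj_hasSum_blocks ht hu (hT v) k, norm_smul]; rfl
    _ ≤ C * ‖T v‖ := (b.proj (t k)).le_of_opNorm_le (hC _) _
    _ ≤ ‖T v‖ * (C + 1) := by linarith [norm_nonneg (T v)]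

/-- A Banach space with an unconditional basis containing neither `c₀` nor `ℓ¹` is reflexive. -/
theorem reflexive_of_no_c0_of_no_l1 (b : UnconditionalSchauderBasis ℕ ℝ B)
    (h0 : ¬ ∃ (T : ZeroAtInftyContinuousMap ℕ ℝ →L[ℝ] B) (c : ℝ), 0 < c ∧
      ∀ v, c * ‖v‖ ≤ ‖T v‖)
    (h1 : ¬ ∃ (T : lp (fun _ : ℕ => ℝ) 1 →L[ℝ] B) (c : ℝ), 0 < c ∧ ∀ v, c * ‖v‖ ≤ ‖T v‖) :
    Function.Surjective (NormedSpace.inclusionInDoubleDual ℝ B) := fun F => by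
  obtain ⟨C, hC⟩ := b.exists_norm_proj_le
  have hC0 : 0 ≤ C := (norm_nonneg _).trans (hC ∅)
  have hproj : ∀ (φ : StrongDual ℝ B) (s : Finset ℕ),
      ∑ i ∈ s, φ (b i) • b.coord i = φ.comp (b.proj s) := fun φ s => by
    ext x
    simp [mul_comm]
  have hM : ∀ s : Finset ℕ, ‖∑ i ∈ s, F (b.coord i) • b i‖ ≤ ‖F‖ * C := fun s => by
    refine NormedSpace.norm_le_dual_bound ℝ _ (by positivity) fun φ => ?_
    have : φ (∑ i ∈ s, F (b.coord i) • b i) = F (φ.comp (b.proj s)) := by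
      rw [← hproj]
      simp [mul_comm]
    rw [this, mul_assoc, mul_comm C]
    refine F.le_opNorm_of_le ((φ.opNorm_comp_le _).trans ?_)
    exact mul_le_mul_of_nonneg_left (hC s) (norm_nonneg φ)
  obtain ⟨x, hx⟩ := b.summable_of_no_c0 h0 hM
  refine ⟨x, ContinuousLinearMap.ext fun φ => ?_⟩
  obtain ⟨φ', hφ'⟩ := b.summable_dual_of_no_l1 h1 φ
  have hφφ' : φ' = φ := ContinuousLinearMap.ext fun y => by
    have e1 := (ContinuousLinearMap.apply ℝ ℝ y).hasSum hφ'
    have e2 := φ.hasSum (b.expansion y)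
    refine e1.unique ?_
    convert! e2 using 2 with i
    simp [mul_comm]
  rw [hφφ'] at hφ'
  rw [NormedSpace.dual_def]
  refine (φ.hasSum hx).unique ?_
  convert! F.hasSum hφ' using 2 with i
  simp [mul_comm]

end UnconditionalSchauderBasis

/-- A Banach space with an unconditional Schauder basis is reflexive iff it contains no
closed subspace linearly isomorphic to `c₀` and none linearly isomorphic to `ℓ¹`. -/
theorem reflexive_iff_no_c0_no_l1 {B : Type*} [NormedAddCommGroup B]
    [NormedSpace ℝ B] [CompleteSpace B] (z : ℕ → B)
    (hb : IsSchauderBasis z) (hu : IsUnconditional z) :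
    Function.Surjective (NormedSpace.inclusionInDoubleDual ℝ B) ↔
      (¬ (∃ (T : ZeroAtInftyContinuousMap ℕ ℝ →L[ℝ] B) (c : ℝ), 0 < c ∧
            ∀ v, c * ‖v‖ ≤ ‖T v‖) ∧
        ¬ (∃ (T : lp (fun _ : ℕ => ℝ) 1 →L[ℝ] B) (c : ℝ), 0 < c ∧
            ∀ v, c * ‖v‖ ≤ ‖T v‖)) := by
  obtain ⟨b⟩ := hb.exists_unconditionalSchauderBasis hu
  exact ⟨fun h => ⟨not_bounded_below_c0_of_reflexive h, not_bounded_below_l1_of_reflexive h⟩,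
    fun h => b.reflexive_of_no_c0_of_no_l1 h.1 h.2⟩
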